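/- Let n ≥ 7 be an integer with n ≡ 1 (mod 3), and let T be a perfect tiling subset of G for parameter n. Then |{t³ : t ∈ T}| = 2n + 1; that is, the cubing map t ↦ t³ is injective on T. -/

import Mathlib

/-- `T` is a perfect tiling subset of `G` for parameter `n`:
`|G| = 2n²+1`, `|T| = 2n+1`, `e ∈ T`, `T = T⁽⁻¹⁾`, and
`T·T = 2·G + T⁽²⁾ + (2n-2)·e` in the integral group ring `ℤ[G]`. -/
def IsPerfectTilingSubset (n : ℕ) {G : Type} [CommGroup G] [Fintype G] [DecidableEq G]
    (T : Finset G) : Prop :=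
  Fintype.card G = 2 * n ^ 2 + 1 ∧
  T.card = 2 * n + 1 ∧
  (1 : G) ∈ T ∧
  T = T.image (·⁻¹) ∧
  (∑ t ∈ T, MonoidAlgebra.single t (1 : ℤ)) * (∑ t ∈ T, MonoidAlgebra.single t (1 : ℤ))
    = 2 * (∑ g : G, MonoidAlgebra.single g (1 : ℤ))
      + (∑ t ∈ T, MonoidAlgebra.single (t ^ 2) (1 : ℤ))
      + MonoidAlgebra.single (1 : G) (2 * (n : ℤ) - 2)

open MonoidAlgebra in
lemma aux_frob {G : Type} [CommGroup G] [Fintype G] [DecidableEq G] (T : Finset G) (g : G)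
    (X : MonoidAlgebra ℤ G)
    (h : (∑ t ∈ T, MonoidAlgebra.single t (1 : ℤ)) ^ 3 = X)
    (hg : g ∉ T.image (· ^ 3)) : (3 : ℤ) ∣ X.coeff g := by
  have : CharP (MonoidAlgebra (ZMod 3) G) 3 :=
    charP_of_injective_algebraMap (algebraMap (ZMod 3) (MonoidAlgebra (ZMod 3) G)).injective 3
  have : Fact (Nat.Prime 3) := ⟨Nat.prime_three⟩
  have h2 := congrArg (MonoidAlgebra.mapRingHom G (Int.castRingHom (ZMod 3))) h
  rw [map_pow, map_sum, sum_pow_char 3] at h2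
  have h3 := congrArg (fun Y => MonoidAlgebra.coeff Y g) h2
  simp only [MonoidAlgebra.coeff_mapRingHom, MonoidAlgebra.mapRingHom_single,
    MonoidAlgebra.single_pow, MonoidAlgebra.coeff_sum, Finsupp.finsetSum_apply] at h3
  rw [Finset.sum_eq_zero] at h3
  · exact (ZMod.intCast_zmod_eq_zero_iff_dvd _ 3).1 (by simpa using h3.symm)
  · intro t ht
    rw [MonoidAlgebra.coeff_single, Finsupp.single_apply, if_neg]
    rintro rfl
    exact hg (Finset.mem_image_of_mem _ ht)

lemma aux_Gmul {G : Type} [CommGroup G] [Fintype G] [DecidableEq G] (T : Finset G) (f : G → G) :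
    (∑ g : G, MonoidAlgebra.single g (1 : ℤ)) * (∑ t ∈ T, MonoidAlgebra.single (f t) (1 : ℤ))
     = (T.card : MonoidAlgebra ℤ G) * ∑ g : G, MonoidAlgebra.single g (1 : ℤ) := by
  rw [Finset.mul_sum, Finset.sum_congr rfl (g := fun _ => ∑ g : G, MonoidAlgebra.single g (1 : ℤ))]
  · rw [Finset.sum_const, nsmul_eq_mul]
  · intro t _
    rw [Finset.sum_mul]
    simp only [MonoidAlgebra.single_mul_single, mul_one]
    exact Fintype.sum_equiv (Equiv.mulRight (f t)) _ _ (fun x => rfl)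

lemma aux_inj_coeff {G : Type} [CommGroup G] (f : G →* G) (hf : Function.Injective f)
    (X : MonoidAlgebra ℤ G) (g : G) :
    (MonoidAlgebra.mapDomainRingHom ℤ f X).coeff (f g) = X.coeff g := by
  show (Finsupp.mapDomain f X.coeff) (f g) = _
  exact Finsupp.mapDomain_apply hf _ _

lemma aux_mul_one {G : Type} [CommGroup G] [Fintype G] [DecidableEq G]
    (X Y : MonoidAlgebra ℤ G) :
    (X * Y).coeff 1 = ∑ g : G, X.coeff g * Y.coeff g⁻¹ := by
  rw [MonoidAlgebra.coeff_mul_apply_left, Finsupp.sum_fintype]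
  · simp
  · simp

lemma aux_A_mul {G : Type} [CommGroup G] [Fintype G] [DecidableEq G] (T : Finset G)
    (Y : MonoidAlgebra ℤ G) :
    ((∑ t ∈ T, MonoidAlgebra.single t (1 : ℤ)) * Y).coeff 1 = ∑ t ∈ T, Y.coeff t⁻¹ := by
  rw [Finset.sum_mul, MonoidAlgebra.coeff_sum, Finsupp.finsetSum_apply]
  simp [MonoidAlgebra.coeff_single_mul_apply]

lemma aux_G_coeff {G : Type} [CommGroup G] [Fintype G] [DecidableEq G] (T : Finset G) (g : G) :
    (∑ g ∈ T, MonoidAlgebra.single g (1 : ℤ)).coeff g = if g ∈ T then 1 else 0 := by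
  rw [MonoidAlgebra.coeff_sum, Finsupp.finsetSum_apply]
  simp [Finsupp.single_apply]

lemma aux_natmul {G : Type} [CommGroup G] (m : ℤ) (Y : MonoidAlgebra ℤ G) (g : G) :
    ((m : MonoidAlgebra ℤ G) * Y).coeff g = m * Y.coeff g := by
  rw [MonoidAlgebra.intCast_def]
  simp

set_option maxHeartbeats 2000000 in
theorem aux_main (n : ℕ) (hn : 7 ≤ n) (hmod : n % 3 = 1)
    {G : Type} [CommGroup G] [Fintype G] [DecidableEq G]
    (T : Finset G) (hT : IsPerfectTilingSubset n T) : False := by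
  obtain ⟨hG, hc, h1, hinv, hmul⟩ := hT
  have hsq : Function.Injective (powMonoidHom 2 : G →* G) := by
    have : (Nat.card G).Coprime 2 := by
      rw [Nat.card_eq_fintype_card, hG]
      simp
    exact (powCoprime this).injective
  set A : MonoidAlgebra ℤ G := ∑ t ∈ T, MonoidAlgebra.single t (1 : ℤ) with hA
  set B : MonoidAlgebra ℤ G := ∑ t ∈ T, MonoidAlgebra.single (t ^ 2) (1 : ℤ) with hB
  set Γ : MonoidAlgebra ℤ G := ∑ g : G, MonoidAlgebra.single g (1 : ℤ) with hΓ
  set D : MonoidAlgebra ℤ G := ∑ t ∈ T, MonoidAlgebra.single ((t ^ 2) ^ 2) (1 : ℤ) with hD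
  set σ := MonoidAlgebra.mapDomainRingHom ℤ (powMonoidHom 2 : G →* G) with hσ
  have hs : ∀ g : G, σ (MonoidAlgebra.single g (1 : ℤ)) = MonoidAlgebra.single (g ^ 2) (1 : ℤ) := by
    intro g; simp [hσ]
  have hσA : σ A = B := by rw [hA, map_sum]; simp only [hs]; rfl
  have hσB : σ B = D := by rw [hB, map_sum]; simp only [hs]; rfl
  have hσΓ : σ Γ = Γ := by
    rw [hΓ, map_sum]; simp only [hs]
    exact Fintype.sum_bijective _ (Finite.injective_iff_bijective.1 hsq) _ _ (fun x => rfl)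
  have hσ1 : ∀ X, (σ X).coeff 1 = X.coeff 1 := by
    intro X
    have := aux_inj_coeff (powMonoidHom 2 : G →* G) hsq X 1
    rwa [map_one] at this
  have hM : MonoidAlgebra.single (1 : G) (2 * (n : ℤ) - 2) = ((2 * (n : ℤ) - 2 : ℤ) : MonoidAlgebra ℤ G) := by
    rw [MonoidAlgebra.intCast_def]; rfl
  rw [hM] at hmul
  generalize hMM : 2 * (n : ℤ) - 2 = M at hmul
  have hBB : B * B = 2 * Γ + D + M := by
    have := congrArg σ hmul
    rw [map_mul, map_add, map_add, map_mul, map_intCast, map_ofNat, hσA, hσB, hσΓ] at this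
    exact this
  have hΓA : Γ * A = ((T.card : ℤ) : MonoidAlgebra ℤ G) * Γ := by
    simpa using aux_Gmul T id
  have hΓB : Γ * B = ((T.card : ℤ) : MonoidAlgebra ℤ G) * Γ := by
    simpa using aux_Gmul T (fun t => t ^ 2)
  have hΓD : Γ * D = ((T.card : ℤ) : MonoidAlgebra ℤ G) * Γ := by
    simpa using aux_Gmul T (fun t => (t ^ 2) ^ 2)
  have hΓΓ : Γ * Γ = ((Fintype.card G : ℤ) : MonoidAlgebra ℤ G) * Γ := by
    simpa using aux_Gmul (Finset.univ : Finset G) id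
  have hΓc : ∀ g, Γ.coeff g = 1 := by intro g; rw [hΓ, aux_G_coeff]; simp
  have hA1 : A.coeff 1 = 1 := by rw [hA, aux_G_coeff, if_pos h1]
  have hB1 : B.coeff 1 = 1 := by rw [← hσA, hσ1, hA1]
  have hD1 : D.coeff 1 = 1 := by rw [← hσB, hσ1, hB1]
  rw [hc] at hΓA hΓB hΓD
  rw [hG] at hΓΓ
  generalize hS : ((2 * n + 1 : ℕ) : ℤ) = S at hΓA hΓB hΓD
  generalize hN : ((2 * n ^ 2 + 1 : ℕ) : ℤ) = N at hΓΓ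
  set P := A * B with hP
  -- symmetry
  have hTi : ∀ t, t ∈ T → t⁻¹ ∈ T := by
    intro t ht; rw [hinv]; exact Finset.mem_image_of_mem _ ht
  set ι := MonoidAlgebra.mapDomainRingHom ℤ (invMonoidHom : G →* G) with hι
  have hιA : ι A = A := by
    rw [hA, map_sum]
    refine Finset.sum_bij' (fun t _ => t⁻¹) (fun t _ => t⁻¹) ?_ ?_ ?_ ?_ ?_
    · exact fun t ht => hTi t ht
    · exact fun t ht => hTi t ht
    · simp
    · simp
    · intro t ht; simp [hι]
  have hιB : ι B = B := by
    rw [hB, map_sum]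
    refine Finset.sum_bij' (fun t _ => t⁻¹) (fun t _ => t⁻¹) ?_ ?_ ?_ ?_ ?_
    · exact fun t ht => hTi t ht
    · exact fun t ht => hTi t ht
    · simp
    · simp
    · intro t ht; simp [hι]
  have hPinv : ∀ g, P.coeff g⁻¹ = P.coeff g := by
    intro g
    have h := aux_inj_coeff (invMonoidHom : G →* G) inv_injective P g
    have h2 : ι P = P := by rw [hP, map_mul, hιA, hιB]
    rw [← hι, h2] at h
    exact h
  -- moments
  set k := P.coeff 1 with hk
  have hBD : (B * D).coeff 1 = k := by
    rw [← hσA, ← hσB, ← map_mul, hσ1, hk]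
  have hPP : P * P = ((4 * N + 4 * S + 4 * M : ℤ) : MonoidAlgebra ℤ G) * Γ + B * D
      + (M : MonoidAlgebra ℤ G) * B + (M : MonoidAlgebra ℤ G) * D + (M : MonoidAlgebra ℤ G) * (M : MonoidAlgebra ℤ G) * 1 := by
    have : P * P = (A * A) * (B * B) := by rw [hP]; ring
    rw [this, hmul, hBB]
    push_cast
    linear_combination 4 * hΓΓ + 2 * hΓD + 2 * hΓB
  have hsum2 : ∑ g : G, P.coeff g * P.coeff g = 4 * N + 4 * S + 4 * M + k + 2 * M + M * M := by
    have h := aux_mul_one P P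
    simp only [hPinv] at h
    rw [← h, hPP, mul_assoc]
    simp only [MonoidAlgebra.coeff_add, Finsupp.add_apply, aux_natmul, hΓc, hBD, hB1, hD1,
      MonoidAlgebra.coeff_one_one]
    ring
  have hAP : A * P = ((2 * S : ℤ) : MonoidAlgebra ℤ G) * Γ + B * B + (M : MonoidAlgebra ℤ G) * B := by
    have : A * P = (A * A) * B := by rw [hP]; ring
    rw [this, hmul]
    push_cast
    linear_combination 2 * hΓB
  have hBB1 : (B * B).coeff 1 = 3 + M := by
    have : (B * B) = ((2 : ℤ) : MonoidAlgebra ℤ G) * Γ + D + (M : MonoidAlgebra ℤ G) * 1 := by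
      rw [hBB]; push_cast; ring
    rw [this]
    simp only [MonoidAlgebra.coeff_add, Finsupp.add_apply, aux_natmul, hΓc, hD1,
      MonoidAlgebra.coeff_one_one]
    ring
  have hsumT : ∑ t ∈ T, P.coeff t = 2 * S + 3 + M + M := by
    have h := aux_A_mul T P
    simp only [hPinv] at h
    rw [← h, ← hA, hAP]
    simp only [MonoidAlgebra.coeff_add, Finsupp.add_apply, aux_natmul, hΓc, hBB1, hB1]
    ring
  have hsum1 : ∑ g : G, P.coeff g = S * S := by
    have h : Γ * P = ((S * S : ℤ) : MonoidAlgebra ℤ G) * Γ := by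
      rw [hP]; push_cast
      linear_combination B * hΓA + (S : MonoidAlgebra ℤ G) * hΓB
    have h2 := aux_A_mul (Finset.univ : Finset G) P
    simp only [hPinv] at h2
    rw [← h2, ← hΓ, h, aux_natmul, hΓc, mul_one]
  -- mod 3
  have hmod3 : ∀ g, g ∉ T.image (· ^ 3) → (3 : ℤ) ∣ P.coeff g := by
    intro g hg
    have h3 : A ^ 3 = ((2 * S : ℤ) : MonoidAlgebra ℤ G) * Γ + P + (M : MonoidAlgebra ℤ G) * A := by
      have : A ^ 3 = (A * A) * A := by ring
      rw [this, hmul, hP]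
      push_cast
      linear_combination 2 * hΓA
    have h4 := aux_frob T g _ h3 hg
    simp only [MonoidAlgebra.coeff_add, Finsupp.add_apply, aux_natmul, hΓc] at h4
    have hM3 : (3 : ℤ) ∣ M := by omega
    have hS3 : (3 : ℤ) ∣ S := by omega
    have h5 : (3 : ℤ) ∣ 2 * S * 1 := by omega
    have h6 := (dvd_add_left (Dvd.dvd.mul_right hM3 (A.coeff g))).1 h4
    exact (dvd_add_right h5).1 h6
  generalize P.coeff = c at *
  -- final inequality
  set f : G → ℤ := fun g => c g * (c g - 3) with hf
  have htot : ∑ g : G, f g = k - 3 := by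
    have : ∑ g : G, f g = ∑ g : G, c g * c g - 3 * ∑ g : G, c g := by
      rw [Finset.mul_sum, ← Finset.sum_sub_distrib]
      exact Finset.sum_congr rfl (fun g _ => by simp only [hf]; ring)
    rw [this, hsum2, hsum1, ← hMM, ← hS, ← hN]
    push_cast; ring
  set I := (T.erase 1).image (· ^ 3) with hI
  have hIc : I.card ≤ 2 * n := by
    refine Finset.card_image_le.trans ?_
    rw [Finset.card_erase_of_mem h1, hc]; simp
  have hpt : ∀ g : G, (if g ∈ T then 5 * c g - 16 else 0) + (if g ∈ I then -2 else 0)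
      + (if g = 1 then k * (k - 3) - (5 * k - 16) else 0) ≤ f g := by
    intro g
    by_cases hg1 : g = 1
    · subst hg1
      simp only [h1, if_true, hf, ← hk]
      split_ifs <;> linarith
    · have ha : -2 ≤ f g := by
        simp only [hf]
        rcases le_or_gt (c g) 1 with h | h <;> nlinarith
      have hb : 5 * c g - 16 ≤ f g := by simp only [hf]; nlinarith [sq_nonneg (c g - 4)]
      by_cases hgT : g ∈ T
      · simp only [hgT, hg1, if_true, if_false]
        split_ifs <;> linarith
      · by_cases hgI : g ∈ I
        · simp only [hgT, hg1, hgI, if_true, if_false]; linarith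
        · simp only [hgT, hg1, hgI, if_false]
          have : g ∉ T.image (· ^ 3) := by
            intro h
            obtain ⟨t, ht, rfl⟩ := Finset.mem_image.1 h
            refine hgI (Finset.mem_image.2 ⟨t, Finset.mem_erase.2 ⟨?_, ht⟩, rfl⟩)
            rintro rfl
            exact hg1 (by simp)
          obtain ⟨d, hd⟩ := hmod3 g this
          simp only [hf, hd]
          rcases le_or_gt d 0 with h | h <;> nlinarith
  have hle := Finset.sum_le_sum (fun g (_ : g ∈ Finset.univ) => hpt g)
  rw [htot] at hle
  simp only [Finset.sum_add_distrib, Finset.sum_ite_mem, Finset.univ_inter, Finset.sum_ite_eq',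
    Finset.mem_univ, if_true, Finset.sum_sub_distrib, ← Finset.mul_sum, hsumT, Finset.sum_const,
    hc, nsmul_eq_mul, Finset.sum_ite_eq] at hle
  have hIc' : (I.card : ℤ) ≤ 2 * n := by exact_mod_cast hIc
  have hn' : (7 : ℤ) ≤ n := by exact_mod_cast hn
  push_cast at hle hS
  nlinarith [sq_nonneg (2 * k - 9)]

theorem stmt9 (n : ℕ) (hn : 7 ≤ n) (hmod : n % 3 = 1)
    {G : Type} [CommGroup G] [Fintype G] [DecidableEq G]
    (T : Finset G) (hT : IsPerfectTilingSubset n T) :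
    (T.image (· ^ 3)).card = 2 * n + 1 := by
  exact (aux_main n hn hmod T hT).elim
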